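/- arXiv:0904.0848 — 3 statements merged into one kernel-verified Lean document; each statement's English description precedes it below -/
import Mathlib

section
/- Let K be a compact metrizable group and Γ a group of continuous automorphisms of K. Then the following are equivalent: (i) Γ is ergodic on K; (ii) for every non-trivial irreducible finite-dimensional unitary representation π of K, the orbit Γ[π] = {[απ] : α ∈ Γ} of the equivalence class [π] under the dual action is infinite; (iii) for every non-trivial finite-dimensional unitary representation π of K (not necessarily irreducible), the orbit Γ[π] is infinite. -/
open MeasureTheory Topology Set

set_option linter.unusedVariables false

namespace ErgZd

variable {K : Type*}

/-- The group of bi-continuous automorphisms of a topological group,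
as a subgroup of `MulAut K`. -/
def ContAut (K : Type*) [Group K] [TopologicalSpace K] : Subgroup (MulAut K) where
  carrier := {α | Continuous α ∧ Continuous α.symm}
  one_mem' := ⟨continuous_id, continuous_id⟩
  mul_mem' := fun {a b} ha hb => ⟨ha.1.comp hb.1, hb.2.comp ha.2⟩
  inv_mem' := fun {a} ha => ⟨ha.2, ha.1⟩

section Defs

variable [Group K] [TopologicalSpace K]

lemma ContAut.continuous (α : ↥(ContAut K)) : Continuous ⇑(α : MulAut K) := α.2.1

lemma ContAut.continuous_symm (α : ↥(ContAut K)) :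
    Continuous ⇑(α : MulAut K).symm := α.2.2

/-- Ergodicity of the action of a set `S` of automorphisms with respect to `μ`:
every invariant Borel set is null or conull. -/
def ErgSet [MeasurableSpace K] (μ : Measure K) (S : Set ↥(ContAut K)) : Prop :=
  ∀ A : Set K, MeasurableSet A → (∀ α ∈ S, (α : MulAut K) '' A = A) → μ A = 0 ∨ μ A = 1

/-- Ergodicity of a single automorphism: ergodicity of the group of its integer powers. -/
def ErgAut [MeasurableSpace K] (μ : Measure K) (α : ↥(ContAut K)) : Prop :=
  ErgSet μ (Set.range fun n : ℤ => α ^ n)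

/-- Distality of the action of a set of automorphisms: for `x ≠ 1`, the identity is
not in the closure of the orbit of `x`. -/
def DistalSet (S : Set ↥(ContAut K)) : Prop :=
  ∀ x : K, x ≠ 1 → (1 : K) ∉ closure ((fun α : ↥(ContAut K) => (α : MulAut K) x) '' S)

/-- Distality of a single automorphism. -/
def DistalAut (α : ↥(ContAut K)) : Prop := DistalSet (Set.range fun n : ℤ => α ^ n)

/-- The descending chain condition for an action: every decreasing
sequence of closed invariant subgroups is eventually constant. -/
def HasDCC (S : Set ↥(ContAut K)) : Prop :=
  ∀ C : ℕ → Subgroup K, (∀ n, IsClosed (C n : Set K)) → (∀ n, C (n + 1) ≤ C n) →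
    (∀ n, ∀ α ∈ S, ∀ x, x ∈ C n ↔ (α : MulAut K) x ∈ C n) → ∃ N, ∀ n, N ≤ n → C n = C N

/-- Restriction of an automorphism to an invariant subgroup. -/
def restrictAut (H : Subgroup K) (α : ↥(ContAut K))
    (h : ∀ x, x ∈ H ↔ (α : MulAut K) x ∈ H) : ↥(ContAut ↥H) := by
  refine ⟨⟨⟨fun x => ⟨(α : MulAut K) x, (h x).mp x.2⟩,
      fun x => ⟨(α : MulAut K).symm x, (h _).mpr (by simpa using x.2)⟩, ?_, ?_⟩, ?_⟩, ?_, ?_⟩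
  · intro x; ext; simp
  · intro x; ext; simp
  · intro x y; ext; simp
  · exact Continuous.subtype_mk ((ContAut.continuous α).comp continuous_subtype_val) _
  · exact Continuous.subtype_mk ((ContAut.continuous_symm α).comp continuous_subtype_val) _

@[simp] lemma restrictAut_coe (H : Subgroup K) (α : ↥(ContAut K))
    (h : ∀ x, x ∈ H ↔ (α : MulAut K) x ∈ H) (x : ↥H) :
    ((((restrictAut H α h) : MulAut ↥H) x : ↥H) : K) = (α : MulAut K) (x : K) := rfl

/-- The automorphism induced on the quotient by an invariant closed normal subgroup. -/
def quotAut (N : Subgroup K) [N.Normal] (α : ↥(ContAut K))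
    (h : ∀ x, x ∈ N ↔ (α : MulAut K) x ∈ N) : ↥(ContAut (K ⧸ N)) := by
  have hmap : N.map ((α : MulAut K) : K ≃* K) = N := by
    ext y
    constructor
    · rintro ⟨x, hx, rfl⟩; exact (h x).mp hx
    · intro hy
      exact ⟨(α : MulAut K).symm y, (h _).mpr (by simpa using hy), by simp⟩
  refine ⟨QuotientGroup.congr N N ((α : MulAut K) : K ≃* K) hmap, ?_, ?_⟩
  · apply (QuotientGroup.isQuotientMap_mk N).continuous_iff.mpr
    have : ⇑(QuotientGroup.congr N N ((α : MulAut K) : K ≃* K) hmap) ∘ (QuotientGroup.mk : K → K ⧸ N)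
        = (QuotientGroup.mk : K → K ⧸ N) ∘ ⇑(α : MulAut K) := by
      funext x
      exact QuotientGroup.congr_mk N N _ hmap x
    rw [this]
    exact QuotientGroup.continuous_mk.comp (ContAut.continuous α)
  · apply (QuotientGroup.isQuotientMap_mk N).continuous_iff.mpr
    have : ⇑(QuotientGroup.congr N N ((α : MulAut K) : K ≃* K) hmap).symm ∘ (QuotientGroup.mk : K → K ⧸ N)
        = (QuotientGroup.mk : K → K ⧸ N) ∘ ⇑((α : MulAut K) : K ≃* K).symm := by
      funext x
      rfl
    rw [this]
    exact QuotientGroup.continuous_mk.comp (ContAut.continuous_symm α)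

end Defs

section Reps

variable [Group K] [TopologicalSpace K]

/-- Unitary equivalence (unitary conjugacy) of `n`-dimensional unitary representations. -/
def URepEquiv {n : ℕ} (π ρ : K →* Matrix.unitaryGroup (Fin n) ℂ) : Prop :=
  ∃ U : Matrix.unitaryGroup (Fin n) ℂ, ∀ x : K,
    (U : Matrix (Fin n) (Fin n) ℂ) * (π x : Matrix (Fin n) (Fin n) ℂ)
      = (ρ x : Matrix (Fin n) (Fin n) ℂ) * (U : Matrix (Fin n) (Fin n) ℂ)

/-- The dual action of an automorphism on representations: `(α • π) x = π (α⁻¹ x)`. -/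
def dualRep {n : ℕ} (α : ↥(ContAut K)) (π : K →* Matrix.unitaryGroup (Fin n) ℂ) :
    K →* Matrix.unitaryGroup (Fin n) ℂ :=
  π.comp (((α : MulAut K).symm : K ≃* K) : K →* K)

/-- The orbit of the equivalence class `[π]` under the dual action of a set `S`
of automorphisms, as a set of equivalence classes. -/
def repOrbit {n : ℕ} (S : Set ↥(ContAut K)) (π : K →* Matrix.unitaryGroup (Fin n) ℂ) :
    Set (Quot (URepEquiv (K := K) (n := n))) :=
  (fun α : ↥(ContAut K) => Quot.mk _ (dualRep α π)) '' S

/-- Irreducibility: there is no invariant subspace other than `⊥` and `⊤`. -/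
def IsIrredRep {n : ℕ} (π : K →* Matrix.unitaryGroup (Fin n) ℂ) : Prop :=
  ∀ W : Submodule ℂ (Fin n → ℂ),
    (∀ x : K, ∀ v ∈ W, (π x : Matrix (Fin n) (Fin n) ℂ).mulVec v ∈ W) → W = ⊥ ∨ W = ⊤

end Reps

section Intertwiners

open scoped ComplexOrder

variable [Group K] {n : ℕ}

/-- The Schur lemma: an intertwiner between two unitary representations of the same dimension,
the first of which is irreducible, is zero unless the representations are unitarily equivalent. -/
lemma eq_zero_or_uRepEquiv_of_intertwines [TopologicalSpace K]
    {ρ₁ ρ₂ : K →* Matrix.unitaryGroup (Fin n) ℂ} (hρ : IsIrredRep ρ₁)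
    {M : Matrix (Fin n) (Fin n) ℂ}
    (hM : ∀ x, (ρ₂ x : Matrix (Fin n) (Fin n) ℂ) * M = M * (ρ₁ x : Matrix (Fin n) (Fin n) ℂ)) :
    M = 0 ∨ URepEquiv ρ₁ ρ₂ := by
  rcases Nat.eq_zero_or_pos n with rfl | hn
  · exact Or.inl (Subsingleton.elim _ _)
  have : Nonempty (Fin n) := ⟨⟨0, hn⟩⟩
  have hM' : ∀ x, M.conjTranspose * (ρ₂ x : Matrix (Fin n) (Fin n) ℂ)
      = (ρ₁ x : Matrix (Fin n) (Fin n) ℂ) * M.conjTranspose := by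
    intro x
    have h := congrArg Matrix.conjTranspose (hM x⁻¹)
    simpa [Matrix.conjTranspose_mul, ← Matrix.star_eq_conjTranspose] using h
  have hN : ∀ x, (M.conjTranspose * M) * (ρ₁ x : Matrix (Fin n) (Fin n) ℂ)
      = (ρ₁ x : Matrix (Fin n) (Fin n) ℂ) * (M.conjTranspose * M) := by
    intro x
    rw [Matrix.mul_assoc, ← hM, ← Matrix.mul_assoc, hM', Matrix.mul_assoc]
  obtain ⟨c, hc⟩ := Module.End.exists_eigenvalue (Matrix.mulVecLin (M.conjTranspose * M))
  have htop := (hρ (Module.End.eigenspace (Matrix.mulVecLin (M.conjTranspose * M)) c) (by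
    intro x v hv
    rw [Module.End.mem_eigenspace_iff, Matrix.mulVecLin_apply] at hv ⊢
    rw [Matrix.mulVec_mulVec, hN, ← Matrix.mulVec_mulVec, hv, Matrix.mulVec_smul])).resolve_left hc
  have hscalar : M.conjTranspose * M = c • 1 := by
    apply Matrix.mulVec_injective
    funext v
    have hv : v ∈ Module.End.eigenspace (Matrix.mulVecLin (M.conjTranspose * M)) c :=
      htop ▸ Submodule.mem_top
    rw [Module.End.mem_eigenspace_iff, Matrix.mulVecLin_apply] at hv
    rw [hv, Matrix.smul_mulVec, Matrix.one_mulVec]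
  have hc0 : 0 ≤ c := by
    have h := (Matrix.posSemidef_conjTranspose_mul_self M).diag_nonneg (i := ⟨0, hn⟩)
    simpa [hscalar] using h
  obtain ⟨r, hr⟩ : ∃ r : ℝ, (r : ℂ) = c :=
    ⟨c.re, Complex.ext (by simp) (by simpa using (Complex.nonneg_iff.1 hc0).2)⟩
  subst hr
  have hr0 : 0 ≤ r := by exact_mod_cast hc0
  rcases hr0.eq_or_lt with rfl | hr
  · left
    exact Matrix.conjTranspose_mul_self_eq_zero.1 (by simpa using hscalar)
  · right
    have hsq : (((Real.sqrt r)⁻¹ : ℝ) : ℂ) * (((Real.sqrt r)⁻¹ : ℝ) : ℂ) * (r : ℂ) = 1 := by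
      rw [← Complex.ofReal_mul, ← Complex.ofReal_mul, ← mul_inv, Real.mul_self_sqrt hr0,
        inv_mul_cancel₀ hr.ne', Complex.ofReal_one]
    refine ⟨⟨(((Real.sqrt r)⁻¹ : ℝ) : ℂ) • M, ?_⟩, fun x => ?_⟩
    · rw [Matrix.mem_unitaryGroup_iff', Matrix.star_eq_conjTranspose, Matrix.conjTranspose_smul,
        Matrix.smul_mul, Matrix.mul_smul, hscalar, smul_smul, smul_smul,
        Complex.star_def, Complex.conj_ofReal, hsq, one_smul]
    · simp only [Matrix.smul_mul, Matrix.mul_smul, hM]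

lemma IsIrredRep.dualRep [TopologicalSpace K] {π : K →* Matrix.unitaryGroup (Fin n) ℂ}
    (hπ : IsIrredRep π) (α : ↥(ContAut K)) : IsIrredRep (dualRep α π) := by
  intro W hW
  refine hπ W fun x v hv => ?_
  simpa [ErgZd.dualRep] using hW ((α : MulAut K) x) v hv

lemma uRepEquiv_trace_eq {π ρ : K →* Matrix.unitaryGroup (Fin n) ℂ} (h : URepEquiv π ρ) (x : K) :
    (π x : Matrix (Fin n) (Fin n) ℂ).trace = (ρ x : Matrix (Fin n) (Fin n) ℂ).trace := by
  obtain ⟨U, hU⟩ := h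
  have h1 : (π x : Matrix (Fin n) (Fin n) ℂ)
      = star (U : Matrix (Fin n) (Fin n) ℂ) * ((ρ x : Matrix (Fin n) (Fin n) ℂ) * U) := by
    rw [← hU, ← Matrix.mul_assoc, Matrix.UnitaryGroup.star_mul_self, Matrix.one_mul]
  rw [h1, Matrix.trace_mul_comm, Matrix.mul_assoc, Unitary.mul_star_self_of_mem U.2, Matrix.mul_one]

/-- A unitary matrix whose trace has real part at least its size is the identity. -/
lemma eq_one_of_le_re_trace (U : Matrix.unitaryGroup (Fin n) ℂ)
    (h : (n : ℝ) ≤ (U : Matrix (Fin n) (Fin n) ℂ).trace.re) : U = 1 := by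
  set N : Matrix (Fin n) (Fin n) ℂ := (U : Matrix (Fin n) (Fin n) ℂ) - 1 with hNdef
  have hN : N.conjTranspose * N
      = 1 - (U : Matrix (Fin n) (Fin n) ℂ).conjTranspose - ((U : Matrix (Fin n) (Fin n) ℂ) - 1) := by
    have hU : (U : Matrix (Fin n) (Fin n) ℂ).conjTranspose * U = 1 :=
      Matrix.UnitaryGroup.star_mul_self U
    rw [hNdef, Matrix.conjTranspose_sub, Matrix.conjTranspose_one, mul_sub, sub_mul, hU]
    simp only [mul_one, one_mul]
    abel
  have hpos := Complex.nonneg_iff.1 (Matrix.posSemidef_conjTranspose_mul_self N).trace_nonneg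
  have hre : (N.conjTranspose * N).trace.re ≤ 0 := by
    rw [hN]
    simp only [Matrix.trace_sub, Matrix.trace_one, Fintype.card_fin, Matrix.trace_conjTranspose,
      Complex.sub_re, Complex.natCast_re, Complex.star_def, Complex.conj_re]
    linarith
  have h0 : (N.conjTranspose * N).trace = 0 :=
    Complex.ext (le_antisymm hre hpos.1) hpos.2.symm
  rw [Matrix.trace_conjTranspose_mul_self_eq_zero_iff] at h0
  exact Subtype.ext (sub_eq_zero.1 h0)

end Intertwiners

section Ergodic

variable [Group K] [TopologicalSpace K]

/-- If `Γ` is ergodic, every non-trivial finite-dimensional unitary representation has an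
infinite orbit. -/
lemma ErgSet.infinite_repOrbit [IsTopologicalGroup K] [MeasurableSpace K] [BorelSpace K]
    {μ : Measure K} [μ.IsOpenPosMeasure] [IsProbabilityMeasure μ]
    {Γ : Subgroup ↥(ContAut K)} (hΓ : ErgSet μ (Γ : Set ↥(ContAut K))) {n : ℕ}
    {π : K →* Matrix.unitaryGroup (Fin n) ℂ} (hπ : Continuous π) (hne : ∃ x, π x ≠ 1) :
    (repOrbit (Γ : Set ↥(ContAut K)) π).Infinite := by
  intro hfin
  obtain ⟨x₀, hx₀⟩ := hne
  refine hx₀ (eq_one_of_le_re_trace _ (le_of_forall_lt fun t ht => ?_))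
  obtain ⟨s, hts, hsn⟩ := exists_between ht
  refine hts.trans_le ?_
  let χ : Quot (URepEquiv (K := K) (n := n)) → K → ℝ :=
    Quot.lift (fun ρ x => (ρ x : Matrix (Fin n) (Fin n) ℂ).trace.re)
      fun ρ₁ ρ₂ h => funext fun x => congrArg Complex.re (uRepEquiv_trace_eq h x)
  have hcont : ∀ c ∈ repOrbit (Γ : Set ↥(ContAut K)) π, Continuous (χ c) := by
    rintro _ ⟨α, -, rfl⟩
    exact Complex.continuous_re.comp (Continuous.matrix_trace (continuous_subtype_val.comp
      (hπ.comp (ContAut.continuous_symm α))))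
  let A : Set K := ⋂ c ∈ repOrbit (Γ : Set ↥(ContAut K)) π, {x | s < χ c x}
  have hA : IsOpen A :=
    hfin.isOpen_biInter fun c hc => isOpen_lt continuous_const (hcont c hc)
  have memA : ∀ x, x ∈ A ↔ ∀ γ ∈ Γ,
      s < (π ((γ : MulAut K).symm x) : Matrix (Fin n) (Fin n) ℂ).trace.re := by
    intro x
    simp only [A, repOrbit, mem_iInter, forall_mem_image]
    rfl
  have hmaps : ∀ α ∈ Γ, ∀ x ∈ A, (α : MulAut K) x ∈ A := by
    intro α hα x hx
    rw [memA] at hx ⊢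
    intro γ hγ
    have h := hx (α⁻¹ * γ) (Γ.mul_mem (Γ.inv_mem hα) hγ)
    exact h
  have hinv : ∀ α ∈ (Γ : Set ↥(ContAut K)), (α : MulAut K) '' A = A := by
    intro α hα
    refine Subset.antisymm (image_subset_iff.2 (hmaps α hα)) fun x hx => ?_
    exact ⟨_, hmaps α⁻¹ (Γ.inv_mem hα) x hx, (α : MulAut K).apply_symm_apply x⟩
  have h1 : (1 : K) ∈ A := by
    rw [memA]
    intro γ _
    simpa using hsn
  have hμA : μ A = 1 :=
    (hΓ A hA.measurableSet hinv).resolve_left (hA.measure_pos μ ⟨1, h1⟩).ne'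
  have hdense : Dense A :=
    Measure.dense_of_ae ((prob_compl_eq_zero_iff hA.measurableSet).2 hμA)
  have hclosed : IsClosed {x | s ≤ (π x : Matrix (Fin n) (Fin n) ℂ).trace.re} :=
    isClosed_le continuous_const (Complex.continuous_re.comp
      (Continuous.matrix_trace (continuous_subtype_val.comp hπ)))
  have hsub : A ⊆ {x | s ≤ (π x : Matrix (Fin n) (Fin n) ℂ).trace.re} :=
    fun x hx => ((memA x).1 hx 1 Γ.one_mem).le
  exact hclosed.closure_subset_iff.2 hsub (hdense x₀)

end Ergodic

section Subrepresentations

variable {H : Type*} [NormedAddCommGroup H] [InnerProductSpace ℂ H]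

/-- A submodule stable under all operators of a representation. -/
def RepInvariant [Group K] (σ : K →* (H →ₗᵢ[ℂ] H)) (W : Submodule ℂ H) : Prop :=
  ∀ x, ∀ v ∈ W, σ x v ∈ W

variable [Group K] {σ : K →* (H →ₗᵢ[ℂ] H)}

lemma inner_rep_apply_left (x : K) (u v : H) :
    inner ℂ (σ x u) v = inner ℂ u (σ x⁻¹ v) := by
  have h : σ x (σ x⁻¹ v) = v := by
    rw [← Function.comp_apply (f := σ x), ← LinearIsometry.coe_mul, ← map_mul,
      mul_inv_cancel, map_one, LinearIsometry.coe_one, id]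
  conv_lhs => rw [← h]
  exact (σ x).inner_map_map _ _

lemma RepInvariant.inf_orthogonal {W W' : Submodule ℂ H} (hW : RepInvariant σ W)
    (hW' : RepInvariant σ W') : RepInvariant σ (W ⊓ W'ᗮ) := by
  intro x v hv
  refine ⟨hW x v hv.1, (Submodule.mem_orthogonal' _ _).2 fun u hu => ?_⟩
  rw [inner_rep_apply_left]
  exact (Submodule.mem_orthogonal' _ _).1 hv.2 _ (hW' _ u hu)

/-- A finite-dimensional invariant subspace on which a unitary representation is non-trivial
contains a minimal non-zero invariant subspace on which it is non-trivial. -/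
lemma exists_minimal_nontrivial_invariant {V : Submodule ℂ H} [FiniteDimensional ℂ V]
    (hV : RepInvariant σ V) (hne : ∃ x, ∃ v ∈ V, σ x v ≠ v) :
    ∃ W ≤ V, RepInvariant σ W ∧ (∃ x, ∃ v ∈ W, σ x v ≠ v) ∧
      ∀ W' ≤ W, RepInvariant σ W' → W' = ⊥ ∨ W' = W := by
  let P : Set (Submodule ℂ H) := {W | W ≤ V ∧ RepInvariant σ W ∧ ∃ x, ∃ v ∈ W, σ x v ≠ v}
  have hP : P.Nonempty := ⟨V, le_rfl, hV, hne⟩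
  obtain ⟨W, hWP, hmin⟩ := exists_minimalFor_of_wellFoundedLT (· ∈ P)
    (fun W : Submodule ℂ H => Module.finrank ℂ W) hP
  obtain ⟨hWV, hW, x, v, hv, hxv⟩ := hWP
  have : FiniteDimensional ℂ W := Submodule.finiteDimensional_of_le hWV
  have htriv : ∀ W' < W, RepInvariant σ W' → ∀ u ∈ W', σ x u = u := by
    intro W' hlt hW' u hu
    by_contra hxu
    have hle : Module.finrank ℂ W ≤ Module.finrank ℂ W' :=
      hmin ⟨hlt.le.trans hWV, hW', x, u, hu, hxu⟩ (Submodule.finrank_mono hlt.le)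
    exact absurd (Submodule.finrank_lt_finrank_of_lt hlt) hle.not_gt
  refine ⟨W, hWV, hW, ⟨x, v, hv, hxv⟩, fun W' hle hW' => ?_⟩
  by_contra! hcon
  have : FiniteDimensional ℂ W' := Submodule.finiteDimensional_of_le hle
  have hlt : W ⊓ W'ᗮ < W := by
    refine inf_le_left.lt_of_ne fun heq => hcon.1 ?_
    rw [Submodule.eq_bot_iff]
    intro u hu
    exact inner_self_eq_zero.1
      ((Submodule.mem_orthogonal _ _).1 (inf_eq_left.1 heq (hle hu)) u hu)
  have hdecomp : v ∈ W' ⊔ W'ᗮ ⊓ W := by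
    rwa [Submodule.sup_orthogonal_inf_of_hasOrthogonalProjection hle]
  obtain ⟨a, ha, b, hb, rfl⟩ := Submodule.mem_sup.1 hdecomp
  rw [map_add, htriv W' (hle.lt_of_ne hcon.2) hW' a ha,
    htriv _ hlt (hW.inf_orthogonal hW') b ⟨hb.2, hb.1⟩] at hxv
  exact hxv rfl

/-- The matrix form of a unitary representation on a finite-dimensional invariant subspace. -/
lemma RepInvariant.exists_matrix_rep {W : Submodule ℂ H} [FiniteDimensional ℂ W]
    (hW : RepInvariant σ W) :
    ∃ (n : ℕ) (b : Fin n → H) (π : K →* Matrix.unitaryGroup (Fin n) ℂ), Orthonormal ℂ b ∧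
      Submodule.span ℂ (range b) = W ∧
      (∀ x i j, (π x : Matrix (Fin n) (Fin n) ℂ) i j = inner ℂ (b i) (σ x (b j))) ∧
      ∀ x j, σ x (b j) = ∑ i, (π x : Matrix (Fin n) (Fin n) ℂ) i j • b i := by
  let e := stdOrthonormalBasis ℂ W
  let b : Fin (Module.finrank ℂ W) → H := fun i => (e i : H)
  have hb : Orthonormal ℂ b := e.orthonormal.comp_linearIsometry W.subtypeₗᵢ
  have hspan : Submodule.span ℂ (range b) = W := by
    have h := congrArg (Submodule.map W.subtype) e.toBasis.span_eq
    rw [Submodule.map_span, ← range_comp, Submodule.map_top, Submodule.range_subtype] at h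
    simpa [Function.comp_def] using h
  let A : K → Matrix (Fin (Module.finrank ℂ W)) (Fin (Module.finrank ℂ W)) ℂ :=
    fun x => Matrix.of fun i j => inner ℂ (b i) (σ x (b j))
  have hexp : ∀ x j, σ x (b j) = ∑ i, A x i j • b i := by
    intro x j
    have h := congrArg (W.subtype) (e.sum_repr' ⟨σ x (b j), hW x _ (e j).2⟩)
    simp only [map_sum, map_smul, Submodule.subtype_apply] at h
    exact h.symm
  have hone : A 1 = 1 := by
    ext i j
    simp [A, orthonormal_iff_ite.1 hb, Matrix.one_apply]
  have hmul : ∀ x y, A (x * y) = A x * A y := by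
    intro x y
    ext i j
    calc inner ℂ (b i) (σ (x * y) (b j)) = inner ℂ (b i) (σ x (σ y (b j))) := by
          rw [map_mul, LinearIsometry.coe_mul, Function.comp_apply]
      _ = ∑ k, A x i k * A y k j := by
          rw [hexp y j]
          simp only [map_sum, map_smul, inner_sum, inner_smul_right, mul_comm (A x i _)]
          rfl
  have hstar : ∀ x, star (A x) = A x⁻¹ := by
    intro x
    ext i j
    simp [A, Matrix.star_apply, inner_rep_apply_left]
  let π : K →* Matrix.unitaryGroup (Fin (Module.finrank ℂ W)) ℂ :=
    { toFun := fun x => ⟨A x, by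
        rw [Matrix.mem_unitaryGroup_iff, hstar, ← hmul, mul_inv_cancel, hone]⟩
      map_one' := Subtype.ext hone
      map_mul' := fun x y => Subtype.ext (hmul x y) }
  exact ⟨_, b, π, hb, hspan, fun _ _ _ => rfl, hexp⟩

/-- The matrix form of a representation on a minimal invariant subspace is irreducible. -/
lemma isIrredRep_of_minimal [TopologicalSpace K] {W : Submodule ℂ H}
    (hmin : ∀ W' ≤ W, RepInvariant σ W' → W' = ⊥ ∨ W' = W) {n : ℕ} {b : Fin n → H}
    {π : K →* Matrix.unitaryGroup (Fin n) ℂ} (hb : LinearIndependent ℂ b)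
    (hspan : Submodule.span ℂ (range b) = W)
    (hexp : ∀ x j, σ x (b j) = ∑ i, (π x : Matrix (Fin n) (Fin n) ℂ) i j • b i) :
    IsIrredRep π := by
  intro Z hZ
  let L : (Fin n → ℂ) →ₗ[ℂ] H := Fintype.linearCombination ℂ b
  have hL : Function.Injective L := hb.fintypeLinearCombination_injective
  have hrange : LinearMap.range L = W := by rw [← hspan, Fintype.range_linearCombination]
  have hσL : ∀ x v, σ x (L v) = L ((π x : Matrix (Fin n) (Fin n) ℂ).mulVec v) := by
    intro x v
    simp only [L, Fintype.linearCombination_apply, map_sum, map_smul, hexp, Matrix.mulVec,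
      dotProduct, Finset.smul_sum, Finset.sum_smul, smul_smul]
    rw [Finset.sum_comm]
    simp only [mul_comm]
  have hinv : RepInvariant σ (Z.map L) := by
    rintro x _ ⟨v, hv, rfl⟩
    exact ⟨_, hZ x v hv, (hσL x v).symm⟩
  rcases hmin _ (hrange ▸ LinearMap.map_le_range) hinv with h | h
  · left
    exact Submodule.map_injective_of_injective hL (h.trans (Submodule.map_bot _).symm)
  · right
    apply Submodule.map_injective_of_injective hL
    rw [h, Submodule.map_top, hrange]

/-- A non-trivial finite-dimensional unitary representation on a subspace that is also stable
under operators implementing `Γ` contains a non-trivial irreducible one with finite orbit. -/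
lemma exists_irredRep_finite_repOrbit [TopologicalSpace K] {V : Submodule ℂ H}
    [FiniteDimensional ℂ V] (hσ : ∀ v, Continuous fun x => σ x v)
    (hV : RepInvariant σ V) (hne : ∃ x, ∃ v ∈ V, σ x v ≠ v)
    {Γ : Subgroup ↥(ContAut K)} (τ : ↥(ContAut K) → (H →ₗᵢ[ℂ] H))
    (hτσ : ∀ α x v, τ α (σ x v) = σ ((α : MulAut K) x) (τ α v))
    (hτV : ∀ α ∈ Γ, ∀ v ∈ V, τ α v ∈ V) :
    ∃ (n : ℕ) (π : K →* Matrix.unitaryGroup (Fin n) ℂ), Continuous π ∧ IsIrredRep π ∧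
      (∃ x, π x ≠ 1) ∧ (repOrbit (Γ : Set ↥(ContAut K)) π).Finite := by
  obtain ⟨W, hWV, hW, ⟨x₀, v₀, hv₀, hx₀⟩, hmin⟩ := exists_minimal_nontrivial_invariant hV hne
  have : FiniteDimensional ℂ W := Submodule.finiteDimensional_of_le hWV
  obtain ⟨n, b, π, hb, hspan, hπ, hexp⟩ := hW.exists_matrix_rep
  have hirr : IsIrredRep π := isIrredRep_of_minimal hmin hb.linearIndependent hspan hexp
  have hcont : Continuous π := by
    refine Continuous.subtype_mk (f := fun x => (π x : Matrix (Fin n) (Fin n) ℂ)) ?_ _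
    refine continuous_matrix fun i j => ?_
    simp only [hπ]
    exact continuous_const.inner (hσ _)
  have hnontriv : π x₀ ≠ 1 := by
    intro h1
    have hfix : ∀ j, σ x₀ (b j) = b j := by
      intro j
      rw [hexp, h1]
      simp [Matrix.one_apply]
    have hle : W ≤ LinearMap.eqLocus (σ x₀).toLinearMap LinearMap.id := by
      rw [← hspan, Submodule.span_le]
      rintro _ ⟨j, rfl⟩
      exact hfix j
    exact hx₀ (hle hv₀)
  have hn : 0 < n := by
    by_contra h
    obtain rfl : n = 0 := by omega
    exact hnontriv (Subsingleton.elim _ _)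
  refine ⟨n, π, hcont, hirr, ⟨x₀, hnontriv⟩, ?_⟩
  have horth : ∀ α β : ↥(ContAut K),
      (Quot.mk URepEquiv (dualRep α π) ≠ Quot.mk URepEquiv (dualRep β π)) →
      ∀ i j, inner ℂ (τ β (b i)) (τ α (b j)) = 0 := by
    intro α β hαβ
    let M : Matrix (Fin n) (Fin n) ℂ := Matrix.of fun i j => inner ℂ (τ β (b i)) (τ α (b j))
    have hexp' : ∀ (γ : ↥(ContAut K)) x j, σ x (τ γ (b j))
        = ∑ i, (dualRep γ π x : Matrix (Fin n) (Fin n) ℂ) i j • τ γ (b i) := by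
      intro γ x j
      have h := hτσ γ ((γ : MulAut K).symm x) (b j)
      rw [MulEquiv.apply_symm_apply] at h
      rw [← h, hexp]
      simp [dualRep]
    have hM : ∀ x, (dualRep β π x : Matrix (Fin n) (Fin n) ℂ) * M
        = M * (dualRep α π x : Matrix (Fin n) (Fin n) ℂ) := by
      intro x
      ext i j
      trans inner ℂ (τ β (b i)) (σ x (τ α (b j)))
      · have hinv : (dualRep β π x : Matrix (Fin n) (Fin n) ℂ)
            = star (dualRep β π x⁻¹ : Matrix (Fin n) (Fin n) ℂ) := by
          rw [map_inv]; simp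
        have h := inner_rep_apply_left (σ := σ) x⁻¹ (τ β (b i)) (τ α (b j))
        rw [inv_inv] at h
        rw [← h, hexp', hinv, Matrix.mul_apply]
        simp [M, Matrix.star_apply, mul_comm]
      · rw [hexp', Matrix.mul_apply]
        simp [M, mul_comm]
    have hM0 : M = 0 := (eq_zero_or_uRepEquiv_of_intertwines (hirr.dualRep α) hM).resolve_right
      fun h => hαβ (Quot.sound h)
    intro i j
    exact congrFun (congrFun hM0 i) j
  by_contra hinf
  obtain ⟨t, htsub, htcard⟩ := Set.Infinite.exists_subset_card_eq hinf (Module.finrank ℂ V + 1)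
  choose! γ hγΓ hγ using fun c (hc : c ∈ t) => htsub hc
  let w : t → V := fun c => ⟨τ (γ c) (b ⟨0, hn⟩),
    hτV _ (hγΓ c c.2) _ (hWV (hspan ▸ Submodule.subset_span (mem_range_self _)))⟩
  have hw : Orthonormal ℂ w := by
    refine ⟨fun c => ?_, fun c c' hcc' => ?_⟩
    · have h := hb.1 ⟨0, hn⟩
      rwa [← (τ (γ c)).norm_map] at h
    · refine horth _ _ ?_ _ _
      have h1 := hγ c c.2
      have h2 := hγ c' c'.2
      simp only at h1 h2
      rw [h1, h2]
      exact fun h => hcc' (Subtype.ext h.symm)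
  have hcard := hw.linearIndependent.fintype_card_le_finrank
  rw [Fintype.card_coe, htcard] at hcard
  omega

end Subrepresentations

section AveragedOperator

open InnerProductSpace

variable {H : Type*} [NormedAddCommGroup H] [InnerProductSpace ℂ H]
  [TopologicalSpace K] {v : K → H}

lemma continuous_rankOne_self (hv : Continuous v) :
    Continuous fun x => rankOne ℂ (v x) (v x) :=
  ((ContinuousLinearMap.smulRightL ℂ H H).continuous.comp
    ((innerSL ℂ).continuous.comp hv)).clm_apply hv

variable [MeasurableSpace K]

/-- The average `∫ |v x⟩⟨v x| dμ(x)` of the rank-one operators of a family of vectors. -/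
noncomputable def averagedRankOne (μ : Measure K) (v : K → H) : H →L[ℂ] H :=
  ∫ x, rankOne ℂ (v x) (v x) ∂μ

variable [CompactSpace K] [OpensMeasurableSpace K]
  {μ : Measure K} [IsFiniteMeasureOnCompacts μ]

lemma integrable_of_continuous {E : Type*} [NormedAddCommGroup E] {f : K → E}
    (hf : Continuous f) : Integrable f μ :=
  hf.integrable_of_hasCompactSupport (HasCompactSupport.of_compactSpace f)

lemma averagedRankOne_apply (hv : Continuous v) (g : H) :
    averagedRankOne μ v g = ∫ x, inner ℂ (v x) g • v x ∂μ := by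
  rw [averagedRankOne,
    ContinuousLinearMap.integral_apply (integrable_of_continuous (continuous_rankOne_self hv))]
  simp

lemma integrable_inner_smul (hv : Continuous v) (g : H) :
    Integrable (fun x => inner ℂ (v x) g • v x) μ :=
  integrable_of_continuous ((hv.inner continuous_const).smul hv)

variable [CompleteSpace H]

lemma isCompactOperator_averagedRankOne [IsProbabilityMeasure μ] (hv : Continuous v) :
    IsCompactOperator (averagedRankOne μ v) := by
  refine (((compactOperator (RingHom.id ℂ) H H).restrictScalars ℝ).convex).integral_mem
    isClosed_setOfPred_isCompactOperator (Filter.Eventually.of_forall fun x => ?_)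
    (integrable_of_continuous (continuous_rankOne_self hv))
  have hid : IsCompactOperator (id : ℂ → ℂ) :=
    (isCompactOperator_id_iff_finiteDimensional (𝕜 := ℂ)).2 inferInstance
  exact (hid.comp_clm (innerSL ℂ (v x))).clm_comp (ContinuousLinearMap.toSpanSingleton ℂ (v x))

lemma inner_averagedRankOne (hv : Continuous v) (f g : H) :
    inner ℂ f (averagedRankOne μ v g) = ∫ x, inner ℂ (v x) g * inner ℂ f (v x) ∂μ := by
  rw [averagedRankOne_apply hv, ← integral_inner (integrable_inner_smul hv g)]
  simp only [inner_smul_right]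

lemma isSymmetric_averagedRankOne (hv : Continuous v) :
    (averagedRankOne μ v : H →ₗ[ℂ] H).IsSymmetric := by
  intro f g
  simp only [ContinuousLinearMap.coe_coe]
  rw [← inner_conj_symm, inner_averagedRankOne hv, inner_averagedRankOne hv, ← integral_conj]
  simp [mul_comm]

/-- The averaged operator commutes with isometries that permute the family of vectors by a
measure-preserving map. -/
lemma averagedRankOne_comm (hv : Continuous v) {θ : K → K} (hθ : MeasurePreserving θ μ μ)
    (U : H →ₗᵢ[ℂ] H) (hU : ∀ x, U (v x) = v (θ x)) (g : H) :
    averagedRankOne μ v (U g) = U (averagedRankOne μ v g) := by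
  have h := integral_map (μ := μ) (φ := θ) hθ.aemeasurable
    (f := fun x => inner ℂ (v x) (U g) • v x)
    (hθ.map_eq.symm ▸ (integrable_inner_smul hv (U g)).aestronglyMeasurable)
  rw [hθ.map_eq] at h
  rw [averagedRankOne_apply hv, averagedRankOne_apply hv, h]
  have h2 := U.toContinuousLinearMap.integral_comp_comm (integrable_inner_smul (μ := μ) hv g)
  simp only [LinearIsometry.coe_toContinuousLinearMap] at h2
  rw [← h2]
  simp only [← hU, LinearIsometry.inner_map_map, map_smul]

lemma averagedRankOne_ne_zero [μ.IsOpenPosMeasure] (hv : Continuous v) {x₀ : K}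
    (hx₀ : v x₀ ≠ 0) : averagedRankOne μ v ≠ 0 := by
  intro h0
  have h := inner_averagedRankOne (μ := μ) hv (v x₀) (v x₀)
  rw [h0, zero_apply, inner_zero_right] at h
  have hre : ∀ x, inner ℂ (v x) (v x₀) * inner ℂ (v x₀) (v x)
      = ((‖inner ℂ (v x) (v x₀)‖ ^ 2 : ℝ) : ℂ) := by
    intro x
    rw [← inner_conj_symm (v x₀) (v x), Complex.mul_conj, Complex.normSq_eq_norm_sq]
  simp only [hre] at h
  rw [integral_complex_ofReal, eq_comm, Complex.ofReal_eq_zero] at h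
  have hc : Continuous fun x => ‖inner ℂ (v x) (v x₀)‖ ^ 2 :=
    ((hv.inner continuous_const).norm).pow 2
  have hpos : 0 < ∫ x, ‖inner ℂ (v x) (v x₀)‖ ^ 2 ∂μ :=
    hc.integral_pos_of_hasCompactSupport_nonneg_nonzero (HasCompactSupport.of_compactSpace _)
      (fun x => by positivity) (x := x₀) (by simpa using hx₀)
  exact hpos.ne' h

/-- The main step: a vector `F` orthogonal to all vectors fixed by a strongly continuous unitary
representation and fixed by operators implementing `Γ` produces a non-trivial irreducible
finite-dimensional representation with finite orbit. -/
lemma exists_irredRep_finite_repOrbit_of_fixed [Group K] {σ : K →* (H →ₗᵢ[ℂ] H)}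
    [μ.IsOpenPosMeasure] [IsProbabilityMeasure μ] (hσ : ∀ v, Continuous fun x => σ x v)
    (hmul : ∀ a : K, MeasurePreserving (a * ·) μ μ)
    {Γ : Subgroup ↥(ContAut K)} (hΓ : ∀ α ∈ Γ, MeasurePreserving (α : MulAut K) μ μ)
    (τ : ↥(ContAut K) → (H →ₗᵢ[ℂ] H))
    (hτσ : ∀ α x v, τ α (σ x v) = σ ((α : MulAut K) x) (τ α v))
    {F : H} (hF : F ≠ 0) (hτF : ∀ α ∈ Γ, τ α F = F)
    (hfix : ∀ g, (∀ x, σ x g = g) → inner ℂ F g = 0) :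
    ∃ (n : ℕ) (π : K →* Matrix.unitaryGroup (Fin n) ℂ), Continuous π ∧ IsIrredRep π ∧
      (∃ x, π x ≠ 1) ∧ (repOrbit (Γ : Set ↥(ContAut K)) π).Finite := by
  let S := averagedRankOne μ fun x => σ x F
  have hScomp : IsCompactOperator S := isCompactOperator_averagedRankOne (hσ F)
  have hS0 : S ≠ 0 := averagedRankOne_ne_zero (hσ F) (x₀ := 1) (by simpa using hF)
  obtain ⟨c, hc, hc0⟩ : ∃ c : ℂ, Module.End.HasEigenvalue (S : H →ₗ[ℂ] H) c ∧ c ≠ 0 := by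
    by_contra! hcon
    exact hS0 ((ContinuousLinearMap.eq_zero_of_forall_hasEigenvalue_eq_zero hScomp
      (isSymmetric_averagedRankOne (hσ F))).1 hcon)
  obtain ⟨g, hg, hg0⟩ := hc.exists_hasEigenvector
  have hfin : FiniteDimensional ℂ (Module.End.eigenspace (S : H →ₗ[ℂ] H) c) :=
    ContinuousLinearMap.finite_dimensional_eigenspace hScomp c hc0
  have hstable : ∀ (U : H →ₗᵢ[ℂ] H), (∀ u, S (U u) = U (S u)) →
      ∀ u ∈ Module.End.eigenspace (S : H →ₗ[ℂ] H) c,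
        U u ∈ Module.End.eigenspace (S : H →ₗ[ℂ] H) c := by
    intro U hU u hu
    rw [Module.End.mem_eigenspace_iff, ContinuousLinearMap.coe_coe] at hu ⊢
    rw [hU, hu, map_smul]
  refine exists_irredRep_finite_repOrbit (V := Module.End.eigenspace (S : H →ₗ[ℂ] H) c) hσ
    (fun a => hstable _ (averagedRankOne_comm (hσ F) (hmul a) _ fun x => ?_)) ?_ τ hτσ
    (fun α hα => hstable _ (averagedRankOne_comm (hσ F) (hΓ α hα) _ fun x => ?_))
  · rw [map_mul, LinearIsometry.coe_mul, Function.comp_apply]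
  · by_contra! hcon
    have hgfix : ∀ x, σ x g = g := fun x => hcon x g hg
    rw [Module.End.mem_eigenspace_iff, ContinuousLinearMap.coe_coe,
      averagedRankOne_apply (hσ F)] at hg
    have hzero : ∀ x, inner ℂ (σ x F) g = 0 := by
      intro x
      rw [inner_rep_apply_left, hgfix, hfix g hgfix]
    simp only [hzero, zero_smul, integral_zero] at hg
    exact (smul_ne_zero hc0 hg0) hg.symm
  · rw [hτσ, hτF α hα]

end AveragedOperator

section RegularRepresentation

variable [Group K] [TopologicalSpace K] [IsTopologicalGroup K] [MeasurableSpace K] [BorelSpace K]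

lemma ContAut.measurePreserving [CompactSpace K] (μ : Measure K) [μ.IsHaarMeasure]
    [IsProbabilityMeasure μ] (α : ↥(ContAut K)) : MeasurePreserving (α : MulAut K) μ μ := by
  refine ⟨(ContAut.continuous α).measurable, ?_⟩
  have h1 : (Measure.map (α : MulAut K) μ).IsHaarMeasure :=
    Measure.isHaarMeasure_map_of_isFiniteMeasure μ ((α : MulAut K) : K →* K)
      (ContAut.continuous α) (α : MulAut K).surjective
  have h2 : IsProbabilityMeasure (Measure.map (α : MulAut K) μ) :=
    Measure.isProbabilityMeasure_map (ContAut.continuous α).aemeasurable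
  exact Measure.isHaarMeasure_eq_of_isProbabilityMeasure _ _

/-- The left regular representation on `L²`. -/
noncomputable def leftRegular (μ : Measure K) [μ.IsMulLeftInvariant] :
    K →* (Lp ℂ 2 μ →ₗᵢ[ℂ] Lp ℂ 2 μ) where
  toFun x := Lp.compMeasurePreservingₗᵢ ℂ (x⁻¹ * ·) (measurePreserving_mul_left μ x⁻¹)
  map_one' := by
    ext1 g
    refine Lp.ext ((Lp.coeFn_compMeasurePreserving _ _).trans ?_)
    simp [Function.comp_def]
  map_mul' x y := by
    ext1 ⟨⟨g⟩, hg⟩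
    refine Subtype.ext ?_
    change AEEqFun.mk _ _ = AEEqFun.mk _ _
    simp [Function.comp_def, mul_assoc]

/-- The action of an automorphism on `L²`. -/
noncomputable def autRegular [CompactSpace K] (μ : Measure K) [μ.IsHaarMeasure]
    [IsProbabilityMeasure μ] (α : ↥(ContAut K)) : Lp ℂ 2 μ →ₗᵢ[ℂ] Lp ℂ 2 μ :=
  Lp.compMeasurePreservingₗᵢ ℂ (α⁻¹ : ↥(ContAut K)).1 (ContAut.measurePreserving μ α⁻¹)

lemma autRegular_leftRegular [CompactSpace K] (μ : Measure K) [μ.IsHaarMeasure]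
    [IsProbabilityMeasure μ] (α : ↥(ContAut K)) (x : K) (g : Lp ℂ 2 μ) :
    autRegular μ α (leftRegular μ x g)
      = leftRegular μ ((α : MulAut K) x) (autRegular μ α g) := by
  obtain ⟨⟨g⟩, hg⟩ := g
  refine Subtype.ext ?_
  change AEEqFun.mk _ _ = AEEqFun.mk _ _
  simp [Function.comp_def]

lemma continuous_leftRegular [CompactSpace K] (μ : Measure K) [μ.IsMulLeftInvariant]
    [IsFiniteMeasure μ] [μ.InnerRegularCompactLTTop] (g : Lp ℂ 2 μ) :
    Continuous fun x => leftRegular μ x g := by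
  let c : C(K, C(K, K)) :=
    (ContinuousMap.mk (fun a : K × K => a.1⁻¹ * a.2) (by fun_prop)).curry
  exact (continuous_const (y := g)).compMeasurePreservingLp c.continuous
    (fun x => measurePreserving_mul_left μ x⁻¹) (by simp)

/-- The vectors fixed by the left regular representation are the constants. -/
lemma ae_eq_const_of_leftRegular_fixed [SecondCountableTopology K] (μ : Measure K)
    [μ.IsMulLeftInvariant] [SFinite μ] {g : Lp ℂ 2 μ} (hg : ∀ x, leftRegular μ x g = g) :
    ∃ c : ℂ, g =ᵐ[μ] Function.const K c := by
  refine Filter.exists_eventuallyEq_const_of_forall_separating MeasurableSet fun U hU => ?_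
  have h : Filter.EventuallyConst (g ⁻¹' U) (ae μ) := by
    refine aeconst_of_forall_preimage_smul_ae_eq K
      ((Lp.aestronglyMeasurable g).aemeasurable.nullMeasurable hU) fun x => ?_
    have hx : g ∘ (x * ·) =ᵐ[μ] g := by
      have h1 : ⇑(leftRegular μ x⁻¹ g) =ᵐ[μ] g ∘ ((x⁻¹)⁻¹ * ·) :=
        Lp.coeFn_compMeasurePreserving _ _
      rw [hg, inv_inv] at h1
      exact h1.symm
    refine (hx.mono fun y hy => ?_).set_eq
    simp only [mem_preimage, smul_eq_mul, ← hy, Function.comp_apply]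
  exact Filter.eventuallyConst_set.1 h

/-- An invariant Borel set that is neither null nor conull produces a non-trivial irreducible
representation with finite orbit. -/
lemma exists_irredRep_finite_repOrbit_of_not_ergSet [CompactSpace K] [SecondCountableTopology K]
    {μ : Measure K} [μ.IsHaarMeasure] [IsProbabilityMeasure μ] [μ.InnerRegularCompactLTTop]
    {Γ : Subgroup ↥(ContAut K)} (hΓ : ¬ ErgSet μ (Γ : Set ↥(ContAut K))) :
    ∃ (n : ℕ) (π : K →* Matrix.unitaryGroup (Fin n) ℂ), Continuous π ∧ IsIrredRep π ∧
      (∃ x, π x ≠ 1) ∧ (repOrbit (Γ : Set ↥(ContAut K)) π).Finite := by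
  simp only [ErgSet] at hΓ
  push Not at hΓ
  obtain ⟨A, hA, hinv, hA0, hA1⟩ := hΓ
  let f : K → ℂ := fun x => A.indicator 1 x - (μ.real A : ℂ)
  have hind : MemLp (A.indicator (1 : K → ℂ)) 2 μ := (memLp_const 1).indicator hA
  have hf : MemLp f 2 μ := hind.sub (memLp_const _)
  have hintegral : ∫ x, f x ∂μ = 0 := by
    rw [integral_sub (hind.integrable (by norm_num)) (integrable_const _),
      integral_indicator hA]
    simp
  refine exists_irredRep_finite_repOrbit_of_fixed (continuous_leftRegular μ)
    (measurePreserving_mul_left μ) (fun α _ => ContAut.measurePreserving μ α) (autRegular μ)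
    (autRegular_leftRegular μ) (F := hf.toLp f) ?_ ?_ ?_
  · intro h0
    have hae : f =ᵐ[μ] 0 := hf.coeFn_toLp.symm.trans (Lp.eq_zero_iff_ae_eq_zero.1 h0)
    obtain ⟨x, hxA, hx⟩ := ((frequently_ae_mem_iff.2 hA0).and_eventually hae).exists
    have h1 : (1 : ℂ) - (μ.real A : ℂ) = 0 := by simpa [f, hxA] using hx
    have h2 : μ.real A = 1 := by exact_mod_cast (sub_eq_zero.1 h1).symm
    exact hA1 ((ENNReal.toReal_eq_one_iff _).1 h2)
  · intro α hα
    have hcomp : f ∘ (α⁻¹ : ↥(ContAut K)).1 = f := by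
      funext x
      have hx : (α : MulAut K).symm x ∈ A ↔ x ∈ A := by
        conv_rhs => rw [← hinv α hα]
        exact ((α : MulAut K).toEquiv.image_eq_preimage_symm A ▸ Iff.rfl)
      by_cases h : x ∈ A <;> simp [f, h, hx.2, mt hx.1]
    change (hf.comp_measurePreserving (ContAut.measurePreserving μ α⁻¹)).toLp _ = _
    exact MemLp.toLp_congr _ _ (Filter.EventuallyEq.of_eq hcomp)
  · intro g hg
    obtain ⟨c, hc⟩ := ae_eq_const_of_leftRegular_fixed μ hg
    rw [L2.inner_def]
    have h : ∀ᵐ x ∂μ, inner ℂ (hf.toLp f x) (g x) = (starRingEnd ℂ) (f x) * c := by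
      filter_upwards [hc, hf.coeFn_toLp] with x hx hx'
      rw [hx, hx', Function.const_apply]
      simp [mul_comm]
    rw [integral_congr_ae h, integral_mul_const, integral_conj, hintegral]
    simp

end RegularRepresentation

/-- Lemma 2.1 / Berend's criterion, extended to finite-dimensional
representations. For a compact metrizable group `K` and a group `Γ` of continuous
automorphisms of `K`, the following are equivalent: (i) `Γ` is ergodic on `K`;
(ii) the orbit of the class of every non-trivial irreducible finite-dimensional unitary
representation under the dual action is infinite; (iii) the same for every non-trivial
finite-dimensional unitary representation. -/
theorem statement0 {K : Type*} [Group K] [TopologicalSpace K] [IsTopologicalGroup K]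
    [CompactSpace K] [TopologicalSpace.MetrizableSpace K]
    [MeasurableSpace K] [BorelSpace K]
    (μ : Measure K) [μ.IsHaarMeasure] [IsProbabilityMeasure μ]
    (Γ : Subgroup ↥(ContAut K)) :
    List.TFAE
      [ErgSet μ (Γ : Set ↥(ContAut K)),
       ∀ (n : ℕ) (π : K →* Matrix.unitaryGroup (Fin n) ℂ), Continuous π →
         IsIrredRep π → (∃ x, π x ≠ 1) → (repOrbit (Γ : Set ↥(ContAut K)) π).Infinite,
       ∀ (n : ℕ) (π : K →* Matrix.unitaryGroup (Fin n) ℂ), Continuous π →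
         (∃ x, π x ≠ 1) → (repOrbit (Γ : Set ↥(ContAut K)) π).Infinite] := by
  have : SecondCountableTopology K := by
    let _ := TopologicalSpace.metrizableSpaceMetric K
    infer_instance
  tfae_have 1 → 3 := fun h n π hπ hne => h.infinite_repOrbit hπ hne
  tfae_have 3 → 2 := fun h n π hπ _ hne => h n π hπ hne
  tfae_have 2 → 1 := by
    intro h
    by_contra hcon
    obtain ⟨n, π, hπ, hirr, hne, hfin⟩ := exists_irredRep_finite_repOrbit_of_not_ergSet hcon
    exact h n π hπ hirr hne hfin
  tfae_finish

end ErgZd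
end

section
/- Let K be a compact metrizable group and Γ a group of continuous automorphisms of K. Suppose there is a decreasing sequence (K_i)_{i≥0} of closed Γ-invariant subgroups of K with K₀ = K and ∩_{i≥0} K_i = {e}, such that for each i ≥ 1 the subgroup K_i is normal in K_{i−1} and the induced action of Γ on the compact quotient group K_{i−1}/K_i is ergodic. Then Γ is ergodic on K. -/
open MeasureTheory Topology Set

set_option linter.unusedVariables false

namespace ErgZd

variable {K : Type*}

section Length

open scoped ENNReal

/-- The properties of `k ↦ μ (k • A ∆ A)` which propagate along the stages: a symmetric
subadditive function on a group, continuous and zero at the identity. -/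
structure IsContLength {G : Type*} [Group G] [TopologicalSpace G] (ψ : G → ℝ≥0∞) : Prop where
  mul_le : ∀ x y, ψ (x * y) ≤ ψ x + ψ y
  inv_eq : ∀ x, ψ x⁻¹ = ψ x
  tendsto_one : Filter.Tendsto ψ (𝓝 1) (𝓝 0)

variable {G : Type*} [Group G] [TopologicalSpace G] {ψ : G → ℝ≥0∞}

lemma IsContLength.map_one (h : IsContLength ψ) : ψ 1 = 0 :=
  tendsto_nhds_unique (tendsto_pure_nhds ψ 1) (h.tendsto_one.mono_left (pure_le_nhds 1))

lemma IsContLength.isOpen_lt [IsTopologicalGroup G] (h : IsContLength ψ) (c : ℝ≥0∞) :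
    IsOpen {x | ψ x < c} := by
  rw [isOpen_iff_mem_nhds]
  intro x hx
  have ht : Filter.Tendsto (fun y => ψ x + ψ (x⁻¹ * y)) (𝓝 x) (𝓝 (ψ x + 0)) := by
    refine tendsto_const_nhds.add (h.tendsto_one.comp ?_)
    simpa using (continuous_const_mul x⁻¹).tendsto x
  rw [add_zero] at ht
  filter_upwards [ht.eventually (gt_mem_nhds hx)] with y hy
  refine lt_of_le_of_lt ?_ hy
  simpa using h.mul_le x (x⁻¹ * y)

lemma IsContLength.comp_subtype (h : IsContLength ψ) (H : Subgroup G) :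
    IsContLength fun x : H => ψ x where
  mul_le x y := h.mul_le x y
  inv_eq x := h.inv_eq x
  tendsto_one := h.tendsto_one.comp (continuous_subtype_val.tendsto (1 : H))

/-- A bound for an invariant length on a closed normal subgroup extends to the whole group
as soon as the action on the quotient is ergodic. -/
lemma IsContLength.le_of_ergSet_quotient [IsTopologicalGroup G] [CompactSpace G]
    [TopologicalSpace.MetrizableSpace G] [MeasurableSpace G] [BorelSpace G]
    (h : IsContLength ψ) (N : Subgroup G) [N.Normal] (hN : IsClosed (N : Set G))
    (Q : Set ↥(ContAut (G ⧸ N)))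
    (hQ : ∀ q ∈ Q, ∃ α : ↥(ContAut G), (∀ x, ψ ((α : MulAut G) x) = ψ x) ∧
      ∀ x : G, (q : MulAut (G ⧸ N)) (x : G ⧸ N) = ((α : MulAut G) x : G))
    (herg : ∀ ν : Measure (G ⧸ N), ν.IsHaarMeasure → IsProbabilityMeasure ν → ErgSet ν Q)
    {b : ℝ≥0∞} (hb : ∀ x ∈ N, ψ x ≤ b) (x : G) : ψ x ≤ b := by
  let := TopologicalSpace.metrizableSpaceMetric G
  have : IsClosed (N : Set G) := hN
  let ν : Measure (G ⧸ N) := Measure.haarMeasure ⊤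
  have : IsProbabilityMeasure ν := ⟨Measure.haarMeasure_self⟩
  refine le_of_forall_pos_le_add fun ε hε => ?_
  obtain ⟨c, hc, hcε⟩ : ∃ c : ℝ≥0∞, 0 < c ∧ c + c = ε :=
    ⟨ε / 2, ENNReal.div_pos hε.ne' ENNReal.ofNat_ne_top, ENNReal.add_halves ε⟩
  set V : Set G := {y | ψ y < c} with hV
  have hV1 : (1 : G) ∈ V := by simpa [hV, h.map_one] using hc
  have hVo : IsOpen V := h.isOpen_lt c
  set U : Set (G ⧸ N) := (QuotientGroup.mk : G → G ⧸ N) '' V with hU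
  have hUo : IsOpen U := QuotientGroup.isOpenMap_coe _ hVo
  have hUinv : ∀ q ∈ Q, (q : MulAut (G ⧸ N)) '' U = U := by
    intro q hq
    obtain ⟨α, hα, hqα⟩ := hQ q hq
    have hαV : (α : MulAut G) '' V = V := by
      ext y
      constructor
      · rintro ⟨z, hz, rfl⟩
        simpa [hV, hα] using hz
      · intro hy
        refine ⟨(α : MulAut G).symm y, ?_, by simp⟩
        have := hα ((α : MulAut G).symm y)
        rw [MulEquiv.apply_symm_apply] at this
        simpa [hV, ← this] using hy
    rw [hU, image_image]
    simp only [hqα]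
    rw [← image_image (QuotientGroup.mk : G → G ⧸ N), hαV]
  have hU1 : ν U = 1 := (herg ν inferInstance inferInstance U hUo.measurableSet hUinv).resolve_left
    (hUo.measure_pos ν ⟨_, 1, hV1, rfl⟩).ne'
  have hxV : IsOpen ((QuotientGroup.mk : G → G ⧸ N) '' ((x * ·) '' V)) :=
    QuotientGroup.isOpenMap_coe _ (isOpenMap_mul_left x _ hVo)
  have hdense : Dense U := Measure.dense_of_ae (μ := ν) (by
    rwa [← mem_ae_iff_prob_eq_one hUo.measurableSet] at hU1)
  obtain ⟨_, ⟨_, ⟨v, hv, rfl⟩, rfl⟩, w, hw, hwv⟩ :=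
    hdense.inter_open_nonempty _ hxV ⟨_, _, ⟨1, hV1, rfl⟩, rfl⟩
  have hl : w⁻¹ * (x * v) ∈ N := QuotientGroup.eq.1 hwv
  calc ψ x = ψ (w * (w⁻¹ * (x * v)) * v⁻¹) := by congr 1; group
    _ ≤ ψ w + ψ (w⁻¹ * (x * v)) + ψ v⁻¹ := (h.mul_le _ _).trans (by gcongr; exact h.mul_le _ _)
    _ ≤ c + b + c := by
      rw [h.inv_eq]
      gcongr
      · exact hw.le
      · exact hb _ hl
      · exact hv.le
    _ = b + ε := by rw [← hcε]; ring

end Length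

section Displacement

open scoped Pointwise symmDiff

variable [Group K] [TopologicalSpace K] [IsTopologicalGroup K] [CompactSpace K]
  [TopologicalSpace.MetrizableSpace K] [MeasurableSpace K] [BorelSpace K]
  (μ : Measure K) [μ.IsHaarMeasure] [IsProbabilityMeasure μ]

lemma isContLength_measure_smul_symmDiff {A : Set K} (hA : MeasurableSet A) :
    IsContLength fun k : K => μ ((k • A) ∆ A) where
  mul_le x y := by
    refine (measure_symmDiff_le _ (x • A) _).trans ?_
    rw [mul_smul, ← smul_set_symmDiff, measure_smul, add_comm]
  inv_eq x := by
    rw [symmDiff_comm, measure_symmDiff_inv_smul]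
  tendsto_one := by
    let f : C(K × K, K) := ⟨fun p => p.1⁻¹ * p.2, by fun_prop⟩
    have ht := tendsto_measure_symmDiff_preimage_nhds_zero (μ := μ) (ν := μ) (s := A)
      (f.curry.continuous.tendsto 1)
      (.of_forall fun k => measurePreserving_mul_left μ k⁻¹)
      (measurePreserving_mul_left μ (1 : K)⁻¹) hA.nullMeasurableSet (measure_ne_top _ _)
    refine ht.congr fun k => ?_
    congr 2
    · ext x
      simp [f, mem_smul_set_iff_inv_smul_mem]
    · ext x
      simp [f]

lemma measurePreserving_contAut (α : ↥(ContAut K)) : MeasurePreserving (α : MulAut K) μ μ := by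
  have hm : Measurable (α : MulAut K) := (ContAut.continuous α).measurable
  refine ⟨hm, ?_⟩
  have := (α : MulAut K).isHaarMeasure_map μ (ContAut.continuous α) (ContAut.continuous_symm α)
  have : IsProbabilityMeasure (μ.map (α : MulAut K)) :=
    Measure.isProbabilityMeasure_map hm.aemeasurable
  exact Measure.isHaarMeasure_eq_of_isProbabilityMeasure _ _

lemma measure_smul_symmDiff_contAut {A : Set K} (hA : MeasurableSet A) (α : ↥(ContAut K))
    (hα : (α : MulAut K) '' A = A) (k : K) :
    μ (((α : MulAut K) k • A) ∆ A) = μ ((k • A) ∆ A) := by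
  have hm : MeasurableSet (((α : MulAut K) k • A) ∆ A) := (hA.const_smul _).symmDiff hA
  rw [← (measurePreserving_contAut μ α).measure_preimage hm.nullMeasurableSet]
  have hpre : (α : MulAut K) ⁻¹' A = A := by
    conv_lhs => rw [← hα]
    exact preimage_image_eq _ (α : MulAut K).injective
  have hmem : ∀ x, (α : MulAut K) x ∈ A ↔ x ∈ A := fun x => by
    rw [← mem_preimage, hpre]
  congr 1
  ext x
  simp only [mem_preimage, mem_symmDiff, mem_smul_set_iff_inv_smul_mem, smul_eq_mul, hmem,
    ← map_inv, ← map_mul]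

lemma measure_eq_zero_or_one_of_smul_symmDiff {A : Set K} (hA : MeasurableSet A)
    (h : ∀ k : K, μ ((k • A) ∆ A) = 0) : μ A = 0 ∨ μ A = 1 := by
  have hc := aeconst_of_forall_smul_ae_eq K (μ := μ) hA.nullMeasurableSet
    fun k => measure_symmDiff_eq_zero_iff.1 (h k)
  rw [Filter.eventuallyConst_set'] at hc
  rcases hc with hc | hc
  · left
    simpa using measure_congr hc
  · right
    simpa using measure_congr hc

end Displacement

/-- A decreasing sequence of closed subgroups with trivial intersection in a compact group
eventually lies in any neighbourhood of the identity. -/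
lemma exists_subgroup_subset_of_iInf_eq_bot [Group K] [TopologicalSpace K] [CompactSpace K]
    {C : ℕ → Subgroup K} (hclosed : ∀ i, IsClosed (C i : Set K)) (hanti : Antitone C)
    (hint : (⨅ i, C i) = ⊥) {V : Set K} (hV : IsOpen V) (h1 : (1 : K) ∈ V) :
    ∃ i, (C i : Set K) ⊆ V := by
  refine exists_subset_nhds_of_compactSpace (V := fun i => (C i : Set K))
    (fun i j => ⟨max i j, hanti (le_max_left _ _), hanti (le_max_right _ _)⟩) hclosed ?_
  intro x hx
  rw [← Subgroup.coe_iInf, hint] at hx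
  rw [Subgroup.mem_bot.1 hx]
  exact hV.mem_nhds h1

/-- Lemma 2.2: stage ergodicity implies ergodicity. Suppose `(K i)` is a
decreasing sequence of closed `Γ`-invariant subgroups of the compact metrizable group `K`
with `K 0 = K` and `⋂ K i = {1}`, each `K (i+1)` normal in `K i`, and the induced action
of `Γ` on each quotient `K i / K (i+1)` ergodic. Then `Γ` is ergodic on `K`. -/
theorem statement1 {K : Type*} [Group K] [TopologicalSpace K] [IsTopologicalGroup K]
    [CompactSpace K] [TopologicalSpace.MetrizableSpace K]
    [MeasurableSpace K] [BorelSpace K]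
    (μ : Measure K) [μ.IsHaarMeasure] [IsProbabilityMeasure μ]
    (Γ : Subgroup ↥(ContAut K))
    (C : ℕ → Subgroup K)
    (hC0 : C 0 = ⊤)
    (hclosed : ∀ i, IsClosed (C i : Set K))
    (hdec : ∀ i, C (i + 1) ≤ C i)
    (hint : (⨅ i, C i) = ⊥)
    (hinv : ∀ i, ∀ α ∈ Γ, ∀ x : K, x ∈ C i ↔ (α : MulAut K) x ∈ C i)
    (hnorm : ∀ i, ((C (i + 1)).subgroupOf (C i)).Normal)
    (herg : ∀ i,
      haveI := hnorm i
      ∀ ν : Measure (↥(C i) ⧸ (C (i + 1)).subgroupOf (C i)), ν.IsHaarMeasure →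
        IsProbabilityMeasure ν →
        ErgSet ν {q | ∃ α, ∃ hα : α ∈ Γ, q =
          quotAut ((C (i + 1)).subgroupOf (C i)) (restrictAut (C i) α (hinv i α hα))
            (fun x => by
              rw [Subgroup.mem_subgroupOf, Subgroup.mem_subgroupOf]
              exact hinv (i + 1) α hα (x : K))}) :
    ErgSet μ (Γ : Set ↥(ContAut K)) := by
  intro A hA hAinv
  obtain ⟨ψ, hψ, hψΓ, hψA⟩ : ∃ ψ : K → ENNReal, IsContLength ψ ∧
      (∀ α ∈ Γ, ∀ x, ψ ((α : MulAut K) x) = ψ x) ∧ ((∀ x, ψ x = 0) → μ A = 0 ∨ μ A = 1) :=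
    ⟨_, isContLength_measure_smul_symmDiff μ hA,
      fun α hα => measure_smul_symmDiff_contAut μ hA α (hAinv α hα),
      measure_eq_zero_or_one_of_smul_symmDiff μ hA⟩
  refine hψA fun k => ?_
  have hstage : ∀ (b : ENNReal) (i : ℕ), (∀ x ∈ C (i + 1), ψ x ≤ b) → ∀ x ∈ C i, ψ x ≤ b := by
    intro b i hb x hx
    have := hnorm i
    have : TopologicalSpace.MetrizableSpace (C i) :=
      IsEmbedding.subtypeVal.metrizableSpace
    have : CompactSpace (C i) := isCompact_iff_compactSpace.1 (hclosed i).isCompact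
    refine (hψ.comp_subtype (C i)).le_of_ergSet_quotient ((C (i + 1)).subgroupOf (C i))
      ((hclosed (i + 1)).preimage continuous_subtype_val) _ ?_ (herg i)
      (fun y hy => hb y hy) ⟨x, hx⟩
    rintro _ ⟨α, hα, rfl⟩
    exact ⟨restrictAut (C i) α (hinv i α hα), fun y => hψΓ α hα y, fun y => rfl⟩
  refine le_antisymm (le_of_forall_gt_imp_ge_of_dense fun ε hε => ?_) zero_le
  obtain ⟨n, hn⟩ := exists_subgroup_subset_of_iInf_eq_bot hclosed (antitone_nat_of_succ_le hdec)
    hint (hψ.isOpen_lt ε) (by simpa [hψ.map_one] using hε)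
  have hbound : ∀ x ∈ C 0, ψ x ≤ ε :=
    Nat.decreasingInduction (motive := fun i _ => ∀ x ∈ C i, ψ x ≤ ε)
      (fun i _ hi => hstage ε i hi) (fun x hx => (hn hx).le) (Nat.zero_le n)
  exact hbound k (hC0 ▸ Subgroup.mem_top k)

end ErgZd
end

section
/- Let K be a compact metrizable totally disconnected (equivalently, zero-dimensional) group and Γ a finitely generated abelian group of continuous automorphisms of K generated by α₁, α₂, …, α_m. Then the following are equivalent: (i) the action of Γ on K is distal; (ii) each α_i is distal on K for i = 1, …, m; (iii) K has arbitrarily small Γ-invariant compact open subgroups, i.e. every neighbourhood of the identity e contains a compact open subgroup of K invariant under every element of Γ. -/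
open MeasureTheory Topology Set

set_option linter.unusedVariables false

namespace ErgZd

variable {K : Type*}

lemma continuous_comp_right [TopologicalSpace K] (q : K → K) :
    Continuous fun p : K → K => p ∘ q :=
  continuous_pi fun x => continuous_apply (q x)

section Enveloping

variable [Group K] [TopologicalSpace K]

/-- The Ellis enveloping semigroup of a group `S` of automorphisms: the closure of `S` in the
topology of pointwise convergence. -/
def enveloping (S : Subgroup ↥(ContAut K)) : Set (K → K) :=
  closure ((fun γ : ↥(ContAut K) => ⇑(γ : MulAut K)) '' (S : Set ↥(ContAut K)))

lemma enveloping_subset {S : Subgroup ↥(ContAut K)} {C : Set (K → K)} (hC : IsClosed C)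
    (h : ∀ γ ∈ S, ⇑(γ : MulAut K) ∈ C) : enveloping S ⊆ C :=
  closure_minimal (image_subset_iff.mpr h) hC

lemma coe_mem_enveloping {S : Subgroup ↥(ContAut K)} {γ : ↥(ContAut K)} (hγ : γ ∈ S) :
    ⇑(γ : MulAut K) ∈ enveloping S :=
  subset_closure ⟨γ, hγ, rfl⟩

lemma comp_mem_enveloping {S : Subgroup ↥(ContAut K)} {p q : K → K}
    (hp : p ∈ enveloping S) (hq : q ∈ enveloping S) : p ∘ q ∈ enveloping S := by
  refine enveloping_subset (C := {p | p ∘ q ∈ enveloping S})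
    (isClosed_closure.preimage (continuous_comp_right q)) (fun γ hγ => ?_) hp
  refine enveloping_subset (C := {q | ⇑(γ : MulAut K) ∘ q ∈ enveloping S})
    (isClosed_closure.preimage (continuous_pi fun x =>
      (ContAut.continuous γ).comp (continuous_apply x))) (fun δ hδ => ?_) hq
  exact coe_mem_enveloping (S.mul_mem hγ hδ)

lemma map_mul_of_mem_enveloping [T2Space K] [ContinuousMul K] {S : Subgroup ↥(ContAut K)}
    {p : K → K} (hp : p ∈ enveloping S) (x y : K) : p (x * y) = p x * p y :=
  enveloping_subset (C := {p | p (x * y) = p x * p y})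
    (isClosed_eq (continuous_apply _) ((continuous_apply x).mul (continuous_apply y)))
    (fun γ _ => map_mul (γ : MulAut K) x y) hp

lemma mapsTo_of_mem_enveloping {S : Subgroup ↥(ContAut K)} {V : Set K} (hV : IsClosed V)
    (hinv : ∀ γ ∈ S, MapsTo (γ : MulAut K) V V) {p : K → K} (hp : p ∈ enveloping S) :
    MapsTo p V V := fun x hx =>
  enveloping_subset (C := {p | p x ∈ V}) (hV.preimage (continuous_apply x))
    (fun γ hγ => hinv γ hγ hx) hp

lemma apply_mem_closure_orbit {S : Subgroup ↥(ContAut K)} {p : K → K} (hp : p ∈ enveloping S)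
    (x : K) :
    p x ∈ closure ((fun γ : ↥(ContAut K) => (γ : MulAut K) x) '' (S : Set ↥(ContAut K))) :=
  enveloping_subset (C := (fun p => p x) ⁻¹' closure _)
    (isClosed_closure.preimage (continuous_apply x))
    (fun γ hγ => subset_closure (mem_image_of_mem _ hγ)) hp

/-- An idempotent of the enveloping semigroup of a distal group is the identity. -/
lemma eq_self_of_idempotent [IsTopologicalGroup K] [T2Space K] {S : Subgroup ↥(ContAut K)}
    (hS : DistalSet (S : Set ↥(ContAut K))) {p : K → K} (hp : p ∈ enveloping S)
    (hpp : p ∘ p = p) (x : K) : p x = x := by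
  have hmul := map_mul_of_mem_enveloping hp
  by_contra hne
  refine hS (x⁻¹ * p x) (fun h => hne (inv_mul_eq_one.mp h).symm) ?_
  have h1 : p (x⁻¹ * p x) = 1 := by
    have hx : p (p x) = p x := congrFun hpp x
    have h := hmul x (x⁻¹ * p x)
    rw [mul_inv_cancel_left, hx] at h
    exact left_eq_mul.mp h
  exact h1 ▸ apply_mem_closure_orbit hp _

/-- For a distal group, no element of the enveloping semigroup moves a point into a closed
invariant set that does not already contain it. -/
lemma mem_of_apply_mem [IsTopologicalGroup K] [T2Space K] [CompactSpace K]
    {S : Subgroup ↥(ContAut K)}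
    (hS : DistalSet (S : Set ↥(ContAut K))) {V : Set K} (hV : IsClosed V)
    (hinv : ∀ γ ∈ S, MapsTo (γ : MulAut K) V V) {p : K → K} (hp : p ∈ enveloping S) {x : K}
    (hx : p x ∈ V) : x ∈ V := by
  let _ : Semigroup (K → K) := { mul := fun p q => p ∘ q, mul_assoc := fun _ _ _ => rfl }
  obtain ⟨q, ⟨hq, hqx⟩, hqq⟩ := exists_idempotent_in_compact_subsemigroup
    (M := K → K) continuous_comp_right (enveloping S ∩ {q | q x ∈ V}) ⟨p, hp, hx⟩
    (isClosed_closure.inter (hV.preimage (continuous_apply x))).isCompact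
    (fun q hq r hr => ⟨comp_mem_enveloping hq.1 hr.1,
      mapsTo_of_mem_enveloping hV hinv hq.1 hr.2⟩)
  exact eq_self_of_idempotent hS hq hqq x ▸ hqx

end Enveloping

section InvariantSubgroups

variable [Group K] [TopologicalSpace K]

lemma mem_iff_of_mem_closure {s : Set ↥(ContAut K)} {V : Set K}
    (h : ∀ γ ∈ s, ∀ x, (γ : MulAut K) x ∈ V ↔ x ∈ V) {γ : ↥(ContAut K)}
    (hγ : γ ∈ Subgroup.closure s) : ∀ x, (γ : MulAut K) x ∈ V ↔ x ∈ V := by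
  induction hγ using Subgroup.closure_induction with
  | mem γ hγ => exact h γ hγ
  | one => exact fun x => Iff.rfl
  | mul γ δ _ _ hγ hδ => exact fun x => (hγ _).trans (hδ x)
  | inv γ _ hγ =>
    intro x
    rw [← hγ]
    change (γ : MulAut K) ((γ : MulAut K).symm x) ∈ V ↔ x ∈ V
    rw [MulEquiv.apply_symm_apply]

lemma comap_eq_of_le [IsTopologicalGroup K] [CompactSpace K] {W : Subgroup K}
    (hW : IsOpen (W : Set K)) (f : K ≃* K) (hle : W ≤ W.comap f.toMonoidHom) :
    W.comap f.toMonoidHom = W := by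
  refine le_antisymm ?_ hle
  have := W.quotient_finite_of_isOpen hW
  have hindex : (W.comap f.toMonoidHom).index = W.index :=
    W.index_comap_of_surjective f.surjective
  have hmul := Subgroup.relIndex_mul_index hle
  rw [hindex] at hmul
  exact Subgroup.relIndex_eq_one.mp
    (mul_eq_right₀ W.index_ne_zero_of_finite |>.mp hmul)

/-- The largest subgroup of `U` invariant under all integer powers of `a`. -/
def invCore (a : ↥(ContAut K)) (U : Subgroup K) : Subgroup K :=
  ⨅ k : ℤ, U.comap ((a ^ k : ↥(ContAut K)) : MulAut K).toMonoidHom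

lemma mem_invCore {a : ↥(ContAut K)} {U : Subgroup K} {x : K} :
    x ∈ invCore a U ↔ ∀ k : ℤ, ((a ^ k : ↥(ContAut K)) : MulAut K) x ∈ U := by
  simp only [invCore, Subgroup.mem_iInf]
  rfl

lemma invCore_le (a : ↥(ContAut K)) (U : Subgroup K) : invCore a U ≤ U :=
  fun _ hx => mem_invCore.mp hx 0

lemma zpow_apply_mem_invCore {a : ↥(ContAut K)} {U : Subgroup K} {x : K} (l : ℤ) :
    ((a ^ l : ↥(ContAut K)) : MulAut K) x ∈ invCore a U ↔ x ∈ invCore a U := by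
  have key : ∀ k : ℤ, ((a ^ k : ↥(ContAut K)) : MulAut K) (((a ^ l : ↥(ContAut K)) : MulAut K) x)
      = ((a ^ (k + l) : ↥(ContAut K)) : MulAut K) x := fun k => by rw [zpow_add]; rfl
  simp only [mem_invCore, key]
  exact ⟨fun h k => by simpa using h (k - l), fun h k => h _⟩

lemma apply_mem_invCore {a : ↥(ContAut K)} {U : Subgroup K} {x : K} :
    (a : MulAut K) x ∈ invCore a U ↔ x ∈ invCore a U := by
  simpa only [zpow_one] using zpow_apply_mem_invCore (a := a) (U := U) (x := x) 1

lemma apply_mem_invCore_of_commute {a γ : ↥(ContAut K)} (h : Commute γ a) {U : Subgroup K}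
    (hU : ∀ x, (γ : MulAut K) x ∈ U ↔ x ∈ U) (x : K) :
    (γ : MulAut K) x ∈ invCore a U ↔ x ∈ invCore a U := by
  simp only [mem_invCore]
  refine forall_congr' fun k => ?_
  rw [← hU (((a ^ k : ↥(ContAut K)) : MulAut K) x)]
  have hk := congrArg (fun δ : ↥(ContAut K) => (δ : MulAut K) x) (h.zpow_right k).eq
  change (γ : MulAut K) (((a ^ k : ↥(ContAut K)) : MulAut K) x)
    = ((a ^ k : ↥(ContAut K)) : MulAut K) ((γ : MulAut K) x) at hk
  rw [hk]

variable [IsTopologicalGroup K] [CompactSpace K] [T2Space K]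

/-- If `a` is distal, a point whose forward orbit stays in an open subgroup `U` has its whole
orbit in `U`. -/
lemma mem_invCore_of_forall_pow {a : ↥(ContAut K)} (ha : DistalAut a) {U : Subgroup K}
    (hU : IsOpen (U : Set K)) {x : K}
    (hx : ∀ n : ℕ, ((a ^ n : ↥(ContAut K)) : MulAut K) x ∈ U) : x ∈ invCore a U := by
  have hUc : IsClosed (U : Set K) := U.isClosed_of_isOpen hU
  have hclosed : IsClosed (invCore a U : Set K) := by
    have : (invCore a U : Set K) =
        ⋂ k : ℤ, ((a ^ k : ↥(ContAut K)) : MulAut K) ⁻¹' (U : Set K) := by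
      ext y; simp [mem_invCore]
    rw [this]
    exact isClosed_iInter fun k => hUc.preimage (ContAut.continuous _)
  have hS : DistalSet (Subgroup.zpowers a : Set ↥(ContAut K)) := by
    rw [Subgroup.coe_zpowers]; exact ha
  obtain ⟨p, hp⟩ := exists_clusterPt_of_compactSpace
    (Filter.map (fun n : ℕ => ⇑((a ^ n : ↥(ContAut K)) : MulAut K)) Filter.atTop)
  have hmem : ∀ C : Set (K → K), IsClosed C →
      (∀ᶠ n : ℕ in Filter.atTop, ⇑((a ^ n : ↥(ContAut K)) : MulAut K) ∈ C) → p ∈ C :=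
    fun C hC h => isClosed_iff_clusterPt.mp hC p (hp.mono (Filter.le_principal_iff.mpr h))
  refine mem_of_apply_mem hS hclosed ?_ (p := p) (hmem _ isClosed_closure
    (Filter.Eventually.of_forall fun n => coe_mem_enveloping
      (Subgroup.npow_mem_zpowers a n))) (x := x) ?_
  · rintro _ ⟨l, rfl⟩ y hy
    exact (zpow_apply_mem_invCore l).mpr hy
  · refine mem_invCore.mpr fun k => ?_
    refine hmem {q | ((a ^ k : ↥(ContAut K)) : MulAut K) (q x) ∈ U}
      (hUc.preimage ((ContAut.continuous (a ^ k)).comp (continuous_apply x))) ?_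
    filter_upwards [Filter.eventually_ge_atTop k.natAbs] with n hn
    obtain ⟨l, hl⟩ := Int.eq_ofNat_of_zero_le (show 0 ≤ k + n by omega)
    have : a ^ k * a ^ n = a ^ l := by
      rw [← zpow_natCast a n, ← zpow_add, hl, zpow_natCast]
    have h := hx l
    rw [← this] at h
    exact h

/-- The invariant core of an open subgroup under a distal automorphism is open. -/
lemma isOpen_invCore {a : ↥(ContAut K)} (ha : DistalAut a) {U : Subgroup K}
    (hU : IsOpen (U : Set K)) : IsOpen (invCore a U : Set K) := by
  let W : ℕ → Subgroup K := fun N =>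
    ⨅ n : Fin N, U.comap ((a ^ ((n : ℕ) + 1) : ↥(ContAut K)) : MulAut K).toMonoidHom
  have mem_W : ∀ N x, x ∈ W N ↔
      ∀ n < N, ((a ^ (n + 1) : ↥(ContAut K)) : MulAut K) x ∈ U := by
    intro N x
    simp only [W, Subgroup.mem_iInf, Fin.forall_iff]
    rfl
  have W_open : ∀ N, IsOpen (W N : Set K) := by
    intro N
    have : (W N : Set K) =
        ⋂ n : Fin N, ((a ^ ((n : ℕ) + 1) : ↥(ContAut K)) : MulAut K) ⁻¹' (U : Set K) := by
      ext y; simp [mem_W, Fin.forall_iff]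
    rw [this]
    exact isOpen_iInter_of_finite fun n => hU.preimage (ContAut.continuous _)
  have apply_inv : ∀ n : ℕ, ∀ x, ((a ^ (n + 1) : ↥(ContAut K)) : MulAut K)
      (((a⁻¹ : ↥(ContAut K)) : MulAut K) x) = ((a ^ n : ↥(ContAut K)) : MulAut K) x := by
    intro n x
    have : a ^ (n + 1) * a⁻¹ = a ^ n := by rw [pow_succ, mul_inv_cancel_right]
    rw [← this]; rfl
  obtain ⟨N, hN⟩ : ∃ N, (W N : Set K) ⊆ U := by
    refine exists_subset_nhds_of_isCompact (directed_of_isDirected_le ?_)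
      (fun N => ((W N).isClosed_of_isOpen (W_open N)).isCompact) fun x hx => hU.mem_nhds ?_
    · exact fun M N hMN x hx => (mem_W M x).mpr fun n hn => (mem_W N x).mp hx n (hn.trans_le hMN)
    · rw [mem_iInter] at hx
      have h : (a : MulAut K) x ∈ invCore a U := mem_invCore_of_forall_pow ha hU fun n => by
        have := (mem_W (n + 1) x).mp (hx (n + 1)) n n.lt_succ_self
        rw [pow_succ] at this
        exact this
      exact invCore_le a U (apply_mem_invCore.mp h)
  have hle : W N ≤ (W N).comap ((a⁻¹ : ↥(ContAut K)) : MulAut K).toMonoidHom := by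
    refine fun x hx => (mem_W N _).mpr fun n hn => ?_
    change ((a ^ (n + 1) : ↥(ContAut K)) : MulAut K)
      (((a⁻¹ : ↥(ContAut K)) : MulAut K) x) ∈ U
    rw [apply_inv]
    cases n with
    | zero => exact hN hx
    | succ n => exact (mem_W N x).mp hx n (by omega)
  have hinv := comap_eq_of_le (W_open N) _ hle
  refine Subgroup.isOpen_mono (H₁ := W N) (fun x hx => mem_invCore.mpr fun k => hN ?_) (W_open N)
  refine (mem_iff_of_mem_closure (s := {a⁻¹}) (V := W N) ?_ ?_ x).mpr hx
  · rintro _ rfl y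
    exact SetLike.ext_iff.mp hinv y
  · exact zpow_mem (inv_mem_iff.mp (Subgroup.subset_closure (mem_singleton a⁻¹))) k

lemma exists_open_invariant_le {ι : Type*} {α : ι → ↥(ContAut K)}
    (hcomm : ∀ i j, α i * α j = α j * α i) (hα : ∀ i, DistalAut (α i)) {U : Subgroup K}
    (hU : IsOpen (U : Set K)) (s : Finset ι) :
    ∃ V : Subgroup K, IsOpen (V : Set K) ∧ V ≤ U ∧
      ∀ i ∈ s, ∀ x, (α i : MulAut K) x ∈ V ↔ x ∈ V := by
  classical
  induction s using Finset.induction_on with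
  | empty => exact ⟨U, hU, le_rfl, by simp⟩
  | insert j s _ ih =>
    obtain ⟨V, hV, hVU, hinv⟩ := ih
    refine ⟨invCore (α j) V, isOpen_invCore (hα j) hV, (invCore_le _ _).trans hVU, fun i hi => ?_⟩
    rcases Finset.mem_insert.mp hi with rfl | hi
    · exact fun x => apply_mem_invCore
    · exact apply_mem_invCore_of_commute (hcomm i j) (hinv i hi)

end InvariantSubgroups

/-- Lemma 3.1. For a finitely generated abelian group `Γ` of continuous
automorphisms of a compact metrizable zero-dimensional (totally disconnected) group `K`,
generated by `α 1, …, α m`, the following are equivalent: (i) `Γ` is distal on `K`;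
(ii) each `α i` is distal on `K`; (iii) `K` has arbitrarily small `Γ`-invariant compact
open subgroups. -/
theorem statement5 {K : Type*} [Group K] [TopologicalSpace K] [IsTopologicalGroup K]
    [CompactSpace K] [TopologicalSpace.MetrizableSpace K] [TotallyDisconnectedSpace K]
    {m : ℕ} (α : Fin m → ↥(ContAut K))
    (hcomm : ∀ i j, α i * α j = α j * α i)
    (Γ : Subgroup ↥(ContAut K)) (hΓ : Γ = Subgroup.closure (Set.range α)) :
    List.TFAE
      [DistalSet (Γ : Set ↥(ContAut K)),
       ∀ i, DistalAut (α i),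
       ∀ U ∈ 𝓝 (1 : K), ∃ V : Subgroup K, IsOpen (V : Set K) ∧ IsCompact (V : Set K) ∧
         (V : Set K) ⊆ U ∧ ∀ γ ∈ Γ, (γ : MulAut K) '' (V : Set K) = (V : Set K)] := by
  tfae_have 1 → 2 := by
    intro h i x hx hmem
    refine h x hx (closure_mono (image_mono ?_) hmem)
    rintro _ ⟨k, rfl⟩
    exact hΓ ▸ zpow_mem (Subgroup.subset_closure (mem_range_self i)) k
  tfae_have 2 → 3 := by
    intro h U hU
    obtain ⟨O, hOU, hO, h1⟩ := mem_nhds_iff.mp hU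
    obtain ⟨H, hH⟩ := ProfiniteGrp.exist_openNormalSubgroup_sub_open_nhds_of_one hO h1
    obtain ⟨V, hV, hVH, hinv⟩ :=
      exists_open_invariant_le hcomm h (U := H.toSubgroup) H.isOpen' Finset.univ
    refine ⟨V, hV, (V.isClosed_of_isOpen hV).isCompact,
      fun x hx => hOU (hH (hVH hx)), fun γ hγ => ?_⟩
    have hγV := mem_iff_of_mem_closure (s := range α) (V := V)
      (by rintro _ ⟨i, rfl⟩; exact hinv i (Finset.mem_univ i)) (hΓ ▸ hγ)
    refine Subset.antisymm (image_subset_iff.mpr fun x hx => (hγV x).mpr hx) fun x hx => ?_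
    exact ⟨(γ : MulAut K).symm x, (hγV _).mp (by simpa using hx), by simp⟩
  tfae_have 3 → 1 := by
    intro h x hx hmem
    obtain ⟨V, hV, -, hVx, hinv⟩ := h {x}ᶜ (isOpen_compl_singleton.mem_nhds hx.symm)
    obtain ⟨_, hyV, γ, hγ, rfl⟩ := mem_closure_iff.mp hmem V hV V.one_mem
    rw [← hinv γ hγ] at hyV
    obtain ⟨z, hz, hzx⟩ := hyV
    exact hVx hz ((γ : MulAut K).injective hzx)
  tfae_finish

end ErgZd
end
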